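/- A finitely generated monoid M is a group if and only if M acts outward properly, coboundedly and idealistically by isometric embeddings on a geodesic quasi-metric space. -/

import Mathlib

open scoped ENNReal NNReal

def IsSemimetric {X : Type*} (d : X → X → ℝ≥0∞) : Prop :=
  (∀ x y, d x y = 0 ↔ x = y) ∧ ∀ x y z, d x z ≤ d x y + d y z

noncomputable def wordDist {M : Type*} [Monoid M] (S : Set M) (x y : M) : ℝ≥0∞ :=
  sInf {n : ℝ≥0∞ | ∃ w : List M, (∀ s ∈ w, s ∈ S) ∧ x * w.prod = y ∧ n = w.length}

noncomputable def setDist {X : Type*} (d : X → X → ℝ≥0∞) (A B : Set X) : ℝ≥0∞ :=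
  ⨅ a ∈ A, ⨅ b ∈ B, d a b

open scoped Pointwise in
theorem exists_length {G : Type} [Group G] (S : Set G) (hS : S.Finite)
    (hc : Submonoid.closure S = ⊤) :
    ∃ l : G → ℕ, l 1 = 0 ∧ (∀ g, l g = 0 → g = 1) ∧ (∀ g h, l (g * h) ≤ l g + l h) ∧
      (∀ g, l g⁻¹ = l g) ∧ (∀ n, {g | l g ≤ n}.Finite) ∧
      (∀ g n, l g ≤ n → ∃ c : ℕ → G, c 0 = 1 ∧ c n = g ∧
        ∀ i j, i ≤ j → l ((c i)⁻¹ * c j) ≤ j - i) := by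
  classical
  set T : Set G := S ∪ S⁻¹ ∪ {1} with hT
  have hTfin : T.Finite := (hS.union hS.inv).union (Set.finite_singleton 1)
  have h1 : (1 : G) ∈ T := by simp [hT]
  have hinv : T⁻¹ = T := by
    simp [hT, Set.union_inv, Set.union_comm]
  have hex : ∀ g : G, ∃ n : ℕ, g ∈ T ^ n := by
    intro g
    have hg : g ∈ Submonoid.closure S := by rw [hc]; trivial
    induction hg using Submonoid.closure_induction with
    | mem x hx => exact ⟨1, by rw [pow_one]; exact Or.inl (Or.inl hx)⟩
    | one => exact ⟨0, by simp⟩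
    | mul x y _ _ hx hy =>
      obtain ⟨n, hn⟩ := hx
      obtain ⟨m, hm⟩ := hy
      exact ⟨n + m, by rw [pow_add]; exact Set.mul_mem_mul hn hm⟩
  have hmono : ∀ {m n : ℕ}, m ≤ n → T ^ m ⊆ T ^ n := fun h => Set.pow_subset_pow_right h1 h
  let l : G → ℕ := fun g => Nat.find (hex g)
  have hl : ∀ g n, l g ≤ n ↔ g ∈ T ^ n := by
    intro g n
    exact ⟨fun h => hmono h (Nat.find_spec (hex g)), fun h => Nat.find_min' (hex g) h⟩
  have hself : ∀ g, g ∈ T ^ l g := fun g => Nat.find_spec (hex g)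
  have hle : ∀ g, l g⁻¹ ≤ l g := by
    intro g
    rw [hl]
    have : g⁻¹ ∈ (T ^ l g)⁻¹ := by simpa using hself g
    rwa [← inv_pow, hinv] at this
  refine ⟨l, ?_, ?_, ?_, ?_, ?_, ?_⟩
  · have := (hl 1 0).2 (by simp)
    omega
  · intro g hg
    have := (hl g 0).1 hg.le
    simpa using this
  · intro g h
    rw [hl, pow_add]
    exact Set.mul_mem_mul (hself g) (hself h)
  · intro g
    have := hle g⁻¹
    rw [inv_inv] at this
    exact le_antisymm (hle g) this
  · intro n
    have : {g | l g ≤ n} = T ^ n := by ext g; exact hl g n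
    rw [this]
    induction n with
    | zero => simp
    | succ n ih =>
      rw [pow_succ]
      exact Set.Finite.mul (ih (by ext g; exact hl g n)) hTfin
  · have key : ∀ n g, g ∈ T ^ n → ∃ c : ℕ → G, c 0 = 1 ∧ c n = g ∧
        ∀ i, (c i)⁻¹ * c (i + 1) ∈ T := by
      intro n
      induction n with
      | zero =>
        intro g hg
        have : g = 1 := by simpa using hg
        exact ⟨fun _ => 1, rfl, this.symm, fun i => by simpa using h1⟩
      | succ n ih =>
        intro g hg
        rw [pow_succ] at hg
        obtain ⟨a, ha, b, hb, rfl⟩ := Set.mem_mul.1 hg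
        obtain ⟨c, hc0, hcn, hcs⟩ := ih a ha
        refine ⟨fun i => if i ≤ n then c i else a * b, by simp [hc0], by simp, ?_⟩
        intro i
        rcases lt_trichotomy i n with h | h | h
        · have h2 : i + 1 ≤ n := h
          simpa [h.le, h2] using hcs i
        · subst h
          simpa [hcn] using hb
        · have h2 : ¬ i ≤ n := by omega
          have h3 : ¬ i + 1 ≤ n := by omega
          simpa [h2, h3] using h1
    intro g n hg
    obtain ⟨c, hc0, hcn, hcs⟩ := key n g ((hl g n).1 hg)
    refine ⟨c, hc0, hcn, ?_⟩
    intro i j hij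
    rw [hl]
    obtain ⟨k, rfl⟩ := Nat.exists_eq_add_of_le hij
    rw [Nat.add_sub_cancel_left]
    clear hij
    induction k with
    | zero => simp
    | succ k ih =>
      rw [pow_succ]
      have := Set.mul_mem_mul ih (hcs (i + k))
      simpa [mul_assoc, add_assoc] using this

theorem group_dir {M : Type*} [Monoid M] {G : Type} [Group G] (e : M ≃* G) (l : G → ℕ)
    (l1 : l 1 = 0) (l0 : ∀ g, l g = 0 → g = 1) (lmul : ∀ g h, l (g * h) ≤ l g + l h)
    (linv : ∀ g, l g⁻¹ = l g) (lfin : ∀ n, {g | l g ≤ n}.Finite)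
    (lgeo : ∀ g n, l g ≤ n → ∃ c : ℕ → G, c 0 = 1 ∧ c n = g ∧
        ∀ i j, i ≤ j → l ((c i)⁻¹ * c j) ≤ j - i) :
    ∃ (X : Type) (d : X → X → ℝ≥0∞) (act : M → X → X),
      IsSemimetric d ∧
      (∀ x, act 1 x = x) ∧
      (∀ m n x, act (m * n) x = act m (act n x)) ∧
      (∀ m x y, d (act m x) (act m y) = d x y) ∧
      (∀ x y : X, d x y ≠ ∞ → ∃ p : ℝ → X, p 0 = x ∧ p (d x y).toReal = y ∧
        ∀ a b : ℝ, 0 ≤ a → a ≤ b → b ≤ (d x y).toReal →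
          d (p a) (p b) ≤ ENNReal.ofReal (b - a)) ∧
      (∃ lam mu : ℝ≥0, ∀ x y : X, d x y ≤ (lam : ℝ≥0∞) * d y x + (mu : ℝ≥0∞)) ∧
      (∃ (x₁ : X) (r : ℝ≥0∞), r ≠ ∞ ∧
        ∀ x : X, ∃ (m : M) (b : X), d x₁ b ≤ r ∧ d b x₁ ≤ r ∧ x = act m b) ∧
      (∀ (x₁ : X) (r : ℝ≥0∞), r ≠ ∞ →
        {m : M | setDist d {y | d x₁ y ≤ r} (act m '' {y | d x₁ y ≤ r}) = 0}.Finite) ∧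
      (∃ x₀ : X, (∀ y, d x₀ y ≠ ∞) ∧
        ∀ m n : M, d (act m x₀) (act n x₀) ≠ ∞ → ∀ g : M, ∃ h : M, n * g = m * h) := by
  classical
  let X := G × Set.Ico (0 : ℝ) 1
  let N : X → X → ℕ := fun x y =>
    max (l (x.1⁻¹ * y.1)) (if (y.2 : ℝ) < x.2 then 1 else 0)
  let D : X → X → ℝ := fun x y => N x y + y.2 - x.2
  have b0 : ∀ x : X, (0 : ℝ) ≤ x.2 := fun x => x.2.2.1
  have b1 : ∀ x : X, (x.2 : ℝ) < 1 := fun x => x.2.2.2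
  have Nl : ∀ x y : X, l (x.1⁻¹ * y.1) ≤ N x y := fun x y => le_max_left _ _
  have Nle : ∀ x y : X, N x y ≤ l (x.1⁻¹ * y.1) + 1 := by
    intro x y
    simp only [N]
    split_ifs <;> omega
  have Nlt : ∀ x y : X, (y.2 : ℝ) < x.2 → 1 ≤ N x y := by
    intro x y h
    simp only [N, if_pos h]
    exact le_max_right _ _
  have Nub : ∀ (x y : X) (n : ℕ), l (x.1⁻¹ * y.1) ≤ n → ((y.2 : ℝ) < x.2 → 1 ≤ n) → N x y ≤ n := by
    intro x y n h h'
    simp only [N]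
    split_ifs with h2
    · exact max_le h (h' h2)
    · exact max_le h (Nat.zero_le _)
  have D0 : ∀ x y : X, 0 ≤ D x y := by
    intro x y
    simp only [D]
    by_cases h : (y.2 : ℝ) < x.2
    · have : (1 : ℝ) ≤ N x y := by exact_mod_cast Nlt x y h
      linarith [b0 y, b1 x]
    · have : (0 : ℝ) ≤ N x y := Nat.cast_nonneg _
      linarith
  have tri : ∀ x y z : X, l (x.1⁻¹ * z.1) ≤ l (x.1⁻¹ * y.1) + l (y.1⁻¹ * z.1) := by
    intro x y z
    have := lmul (x.1⁻¹ * y.1) (y.1⁻¹ * z.1)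
    simpa [mul_assoc] using this
  have sym : ∀ x y : X, l (x.1⁻¹ * y.1) = l (y.1⁻¹ * x.1) := by
    intro x y
    rw [← linv]; simp
  have lD : ∀ x y : X, (l (x.1⁻¹ * y.1) : ℝ) ≤ D x y + 1 := by
    intro x y
    have : (l (x.1⁻¹ * y.1) : ℝ) ≤ N x y := by exact_mod_cast Nl x y
    simp only [D]
    linarith [b0 y, b1 x]
  have Dl : ∀ x y : X, D x y ≤ l (x.1⁻¹ * y.1) + 2 := by
    intro x y
    have : (N x y : ℝ) ≤ l (x.1⁻¹ * y.1) + 1 := by exact_mod_cast Nle x y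
    simp only [D]
    linarith [b0 x, b1 y]
  let act : M → X → X := fun m x => (e m * x.1, x.2)
  have Dact : ∀ m x y, D (act m x) (act m y) = D x y := by
    intro m x y
    simp [D, N, act, mul_assoc]
  let z : Set.Ico (0 : ℝ) 1 := ⟨0, by norm_num⟩
  refine ⟨X, fun x y => ENNReal.ofReal (D x y), act, ⟨?_, ?_⟩, ?_, ?_, ?_, ?_, ?_, ?_, ?_, ?_⟩
  · intro x y
    rw [ENNReal.ofReal_eq_zero]
    constructor
    · intro h
      have hD : D x y = 0 := le_antisymm h (D0 x y)
      have hN : N x y < 1 := by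
        have : (N x y : ℝ) < 1 := by
          simp only [D] at hD
          linarith [b0 y, b1 x]
        exact_mod_cast this
      have hN0 : N x y = 0 := by omega
      have h1 : l (x.1⁻¹ * y.1) = 0 := by have := Nl x y; omega
      have h2 := l0 _ h1
      have h3 : x.1 = y.1 := inv_mul_eq_one.1 h2
      simp only [D, hN0] at hD
      refine Prod.ext h3 (Subtype.ext ?_)
      push_cast at hD
      linarith
    · rintro rfl
      simp [D, N, l1]
  · intro x y w
    rw [← ENNReal.ofReal_add (D0 _ _) (D0 _ _)]
    apply ENNReal.ofReal_le_ofReal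
    have : N x w ≤ N x y + N y w := by
      apply Nub
      · exact (tri x y w).trans (add_le_add (Nl _ _) (Nl _ _))
      · intro h
        by_cases h2 : (y.2 : ℝ) < x.2
        · have := Nlt x y h2; omega
        · have := Nlt y w (by linarith); omega
    have : (N x w : ℝ) ≤ N x y + N y w := by exact_mod_cast this
    simp only [D]
    linarith
  · intro x; simp [act]
  · intro m n x; simp [act, mul_assoc]
  · intro m x y; simp only [Dact]
  · intro x y _
    simp only [ENNReal.toReal_ofReal (D0 _ _)]
    obtain ⟨c, hc0, hcn, hc⟩ := lgeo (x.1⁻¹ * y.1) (N x y) (Nl x y)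
    refine ⟨fun a => (x.1 * c ⌊(x.2 : ℝ) + a⌋₊,
      ⟨Int.fract ((x.2 : ℝ) + a), Int.fract_nonneg _, Int.fract_lt_one _⟩), ?_, ?_, ?_⟩
    · have h1 : ⌊(x.2 : ℝ)⌋₊ = 0 := Nat.floor_eq_zero.2 (b1 x)
      refine Prod.ext ?_ (Subtype.ext ?_)
      · simp [h1, hc0]
      · simpa using Int.fract_eq_self.2 ⟨b0 x, b1 x⟩
    · have h1 : (x.2 : ℝ) + D x y = y.2 + N x y := by simp only [D]; ring
      have h2 : ⌊(y.2 : ℝ)⌋₊ = 0 := Nat.floor_eq_zero.2 (b1 y)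
      refine Prod.ext ?_ (Subtype.ext ?_)
      · simp only [h1, Nat.floor_add_natCast (b0 y), h2, zero_add, hcn]
        simp
      · simp only [h1, Int.fract_add_natCast]
        exact Int.fract_eq_self.2 ⟨b0 y, b1 y⟩
    · intro a b ha hab _
      apply ENNReal.ofReal_le_ofReal
      have hA : 0 ≤ (x.2 : ℝ) + a := by linarith [b0 x]
      have hB : 0 ≤ (x.2 : ℝ) + b := by linarith
      have hAB : (x.2 : ℝ) + a ≤ x.2 + b := by linarith
      have e1 : (x.2 : ℝ) + b - (x.2 + a) = b - a := by ring
      rw [← e1]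
      clear e1
      beta_reduce
      generalize (x.2 : ℝ) + a = A at *
      generalize (x.2 : ℝ) + b = B at *
      have fA : Int.fract A = A - ⌊A⌋₊ := by
        rw [Int.fract, natCast_floor_eq_intCast_floor hA]
      have fB : Int.fract B = B - ⌊B⌋₊ := by
        rw [Int.fract, natCast_floor_eq_intCast_floor hB]
      have hfl : ⌊A⌋₊ ≤ ⌊B⌋₊ := Nat.floor_mono hAB
      have hN := Nub (x.1 * c ⌊A⌋₊, ⟨Int.fract A, Int.fract_nonneg _, Int.fract_lt_one _⟩)
        (x.1 * c ⌊B⌋₊, ⟨Int.fract B, Int.fract_nonneg _, Int.fract_lt_one _⟩)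
        (⌊B⌋₊ - ⌊A⌋₊) (by simpa [mul_assoc] using hc _ _ hfl) (by
          intro h
          simp only [fA, fB] at h
          by_contra h3
          have h4 : ⌊A⌋₊ = ⌊B⌋₊ := by omega
          rw [h4] at h
          linarith)
      have hN' := (Nat.cast_le (α := ℝ)).2 hN
      rw [Nat.cast_sub hfl] at hN'
      simp only [D]
      linarith
  · refine ⟨1, 3, ?_⟩
    intro x y
    have h : D x y ≤ D y x + 3 := by
      have h1 := Dl x y
      have h2 := lD y x
      rw [sym] at h1
      linarith
    calc ENNReal.ofReal (D x y) ≤ ENNReal.ofReal (D y x + 3) := ENNReal.ofReal_le_ofReal h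
      _ = _ := by
        rw [ENNReal.ofReal_add (D0 _ _) (by norm_num)]
        simp
  · refine ⟨(1, z), ENNReal.ofReal 2, ENNReal.ofReal_ne_top, ?_⟩
    intro x
    refine ⟨e.symm x.1, (1, x.2), ?_, ?_, ?_⟩
    · apply ENNReal.ofReal_le_ofReal
      have := Dl (1, z) (1, x.2)
      simpa [l1] using this
    · apply ENNReal.ofReal_le_ofReal
      have := Dl (1, x.2) (1, z)
      simpa [l1] using this
    · simp [act]
  · intro x r hr
    obtain ⟨K, hK⟩ := exists_nat_ge (2 * r.toReal + 4)
    have hfin : ((fun m : M => x.1⁻¹ * (e m * x.1)) ⁻¹' {g | l g ≤ K}).Finite := by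
      apply (lfin K).preimage
      intro a _ b _ h
      simpa using h
    refine hfin.subset ?_
    intro m hm
    simp only [Set.mem_setOf_eq, Set.mem_preimage] at hm ⊢
    have hlt : setDist (fun x y => ENNReal.ofReal (D x y)) {y | ENNReal.ofReal (D x y) ≤ r}
        (act m '' {y | ENNReal.ofReal (D x y) ≤ r}) < 1 := by rw [hm]; exact zero_lt_one
    simp only [setDist, iInf_lt_iff] at hlt
    obtain ⟨a, ha, b', ⟨b, hb, rfl⟩, hab⟩ := hlt
    simp only [Set.mem_setOf_eq] at ha hb
    have ha' : D x a ≤ r.toReal := (ENNReal.ofReal_le_iff_le_toReal hr).1 ha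
    have hb' : D x b ≤ r.toReal := (ENNReal.ofReal_le_iff_le_toReal hr).1 hb
    have hab' : D a (act m b) < 1 := by simpa using hab
    have t1 := (Nat.cast_le (α := ℝ)).2 (tri x a (act m x))
    have t2 := (Nat.cast_le (α := ℝ)).2 (tri a (act m b) (act m x))
    have t3 : l ((act m b).1⁻¹ * (act m x).1) = l (x.1⁻¹ * b.1) := by
      rw [sym x b]; simp [act, mul_assoc]
    rw [t3] at t2
    push_cast at t1 t2
    have u1 := lD x a
    have u2 := lD x b
    have u3 := lD a (act m b)
    have : (l (x.1⁻¹ * (act m x).1) : ℝ) ≤ K := by linarith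
    exact_mod_cast this
  · refine ⟨(1, z), fun y => ENNReal.ofReal_ne_top, ?_⟩
    intro m n _ g
    refine ⟨e.symm ((e m)⁻¹ * e (n * g)), ?_⟩
    apply e.injective
    simp

theorem stmt_13 {M : Type*} [Monoid M]
    (hfg : ∃ S : Set M, S.Finite ∧ Submonoid.closure S = ⊤) :
    (∀ m : M, ∃ n : M, m * n = 1 ∧ n * m = 1) ↔
    ∃ (X : Type) (d : X → X → ℝ≥0∞) (act : M → X → X),
      IsSemimetric d ∧
      (∀ x, act 1 x = x) ∧
      (∀ m n x, act (m * n) x = act m (act n x)) ∧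
      (∀ m x y, d (act m x) (act m y) = d x y) ∧
      (∀ x y : X, d x y ≠ ∞ → ∃ p : ℝ → X, p 0 = x ∧ p (d x y).toReal = y ∧
        ∀ a b : ℝ, 0 ≤ a → a ≤ b → b ≤ (d x y).toReal →
          d (p a) (p b) ≤ ENNReal.ofReal (b - a)) ∧
      (∃ lam mu : ℝ≥0, ∀ x y : X, d x y ≤ (lam : ℝ≥0∞) * d y x + (mu : ℝ≥0∞)) ∧
      (∃ (x₁ : X) (r : ℝ≥0∞), r ≠ ∞ ∧
        ∀ x : X, ∃ (m : M) (b : X), d x₁ b ≤ r ∧ d b x₁ ≤ r ∧ x = act m b) ∧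
      (∀ (x₁ : X) (r : ℝ≥0∞), r ≠ ∞ →
        {m : M | setDist d {y | d x₁ y ≤ r} (act m '' {y | d x₁ y ≤ r}) = 0}.Finite) ∧
      (∃ x₀ : X, (∀ y, d x₀ y ≠ ∞) ∧
        ∀ m n : M, d (act m x₀) (act n x₀) ≠ ∞ → ∀ g : M, ∃ h : M, n * g = m * h) := by
  constructor
  · intro hg
    obtain ⟨S, hS, hc⟩ := hfg
    have hcount : Countable M := by
      have : Countable S := hS.countable.to_subtype
      refine Function.Surjective.countable (f := fun w : List S => (w.map Subtype.val).prod) ?_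
      intro m
      have hm : m ∈ Submonoid.closure S := by rw [hc]; trivial
      obtain ⟨w, hw, rfl⟩ := Submonoid.exists_list_of_mem_closure hm
      lift w to List S using hw
      exact ⟨w, rfl⟩
    have : Small.{0} M := inferInstance
    let e : M ≃* Shrink.{0} M := Shrink.mulEquiv.symm
    choose iv h1 h2 using hg
    letI : Group (Shrink.{0} M) :=
      { (inferInstance : Monoid (Shrink.{0} M)) with
        inv := fun x => e (iv (e.symm x))
        inv_mul_cancel := by
          intro x
          change e (iv (e.symm x)) * x = 1
          apply e.symm.injective
          rw [map_mul, e.symm_apply_apply, h2, map_one] }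
    obtain ⟨l, a1, a2, a3, a4, a5, a6⟩ := exists_length (e '' S) (hS.image _) (by
      have := MonoidHom.map_mclosure e.toMonoidHom S
      rw [hc] at this
      change Submonoid.closure (e.toMonoidHom '' S) = ⊤
      rw [← this, ← MonoidHom.mrange_eq_map]
      exact MonoidHom.mrange_eq_top.2 e.surjective)
    exact group_dir e l a1 a2 a3 a4 a5 a6
  · rintro ⟨X, d, act, _, hone, _, _, _, ⟨lam, mu, hq⟩, _, _, x₀, hfin, hid⟩
    have hr : ∀ m : M, ∃ h : M, m * h = 1 := by
      intro m
      have h1 : d (act m x₀) (act 1 x₀) ≠ ∞ := by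
        rw [hone]
        refine ne_top_of_le_ne_top ?_ (hq _ _)
        exact ENNReal.add_ne_top.2
          ⟨ENNReal.mul_ne_top ENNReal.coe_ne_top (hfin _), ENNReal.coe_ne_top⟩
      obtain ⟨h, hh⟩ := hid m 1 h1 1
      exact ⟨h, by rw [← hh, one_mul]⟩
    intro m
    obtain ⟨n, hn⟩ := hr m
    obtain ⟨k, hk⟩ := hr n
    have : m = k := by
      calc m = m * (n * k) := by rw [hk, mul_one]
        _ = k := by rw [← mul_assoc, hn, one_mul]
    exact ⟨n, hn, by rw [this, hk]⟩
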